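/- arXiv:hep-th/0301100 — 2 statements merged into one kernel-verified Lean document; each statement's English description precedes it below -/
import Mathlib

section
/- Let n ≥ 2. There exists a constant c_n > 0, depending only on n, such that for every Schwartz function f on (ℝ⁴)^n and every x ∈ ℝ⁴, both of the following integrals converge absolutely and ∫_{(ℝ⁴)^n} f̌(k₁,…,k_n) r_n(k₁,…,k_n) e^{i(k₁+…+k_n)·x} dk₁⋯dk_n = c_n ∫_{(ℝ⁴)^{n−1}} f( x+a₁, …, x+a_{n−1}, x−(a₁+…+a_{n−1}) ) exp( −(1/2)( Σ_{j=1}^{n−1} |a_j|_E² + |a₁+…+a_{n−1}|_E² ) ) da₁⋯da_{n−1}. -/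
open MeasureTheory
open scoped BigOperators

/-- The Minkowski pairing `k·x = k⁰x⁰ − 𝐤·𝐱` on ℝ⁴. -/
noncomputable def mink (k x : Fin 4 → ℝ) : ℝ :=
  k 0 * x 0 - (k 1 * x 1 + k 2 * x 2 + k 3 * x 3)

/-- The regularizing kernel `r_n`. -/
noncomputable def regKernel (n : ℕ) (k : Fin n → Fin 4 → ℝ) : ℝ :=
  Real.exp (-(1/2) * ∑ μ : Fin 4,
    ((∑ j, (k j μ) ^ 2) - (1 / (n : ℝ)) * ∑ j, ∑ l, k j μ * k l μ))

/-- The inverse Fourier transform (with Minkowski pairing) of a Schwartz function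
on `(ℝ⁴)^n`. -/
noncomputable def invFT {n : ℕ} (f : SchwartzMap (Fin n → Fin 4 → ℝ) ℂ)
    (k : Fin n → Fin 4 → ℝ) : ℂ :=
  (((2 * Real.pi) ^ (4 * n) : ℝ)⁻¹ : ℂ) *
    ∫ y : Fin n → Fin 4 → ℝ,
      f y * Complex.exp (-Complex.I * ((∑ j, mink (k j) (y j) : ℝ) : ℂ))

/-- The point `(x+a₁, …, x+a_{n−1}, x−(a₁+…+a_{n−1})) ∈ (ℝ⁴)^n`. -/
noncomputable def diagShift (n : ℕ) (x : Fin 4 → ℝ) (a : Fin (n - 1) → Fin 4 → ℝ) :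
    Fin n → Fin 4 → ℝ :=
  fun j => if h : (j : ℕ) < n - 1 then x + a ⟨j, h⟩ else x - ∑ i, a i

/-- Linear change of variables up to a positive constant. -/
lemma lin_cov {E F : Type*} [NormedAddCommGroup E] [NormedSpace ℝ E] [FiniteDimensional ℝ E]
    [MeasureSpace E] [BorelSpace E] [(volume : Measure E).IsAddHaarMeasure]
    [NormedAddCommGroup F] [NormedSpace ℝ F] [FiniteDimensional ℝ F]
    [MeasureSpace F] [BorelSpace F] [(volume : Measure F).IsAddHaarMeasure]
    (L : E ≃ₗ[ℝ] F) :
    ∃ c : ℝ, 0 < c ∧ (∀ g : F → ℂ, (∫ x, g (L x)) = (c : ℂ) * ∫ y, g y) ∧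
      ∀ g : F → ℂ, Integrable (fun x => g (L x)) ↔ Integrable g := by
  have hL : (volume.map L.toContinuousLinearEquiv : Measure F).IsAddHaarMeasure :=
    L.toContinuousLinearEquiv.isAddHaarMeasure_map _
  have h1 := Measure.isAddLeftInvariant_eq_smul (volume.map L.toContinuousLinearEquiv : Measure F)
    (volume : Measure F)
  set c := Measure.addHaarScalarFactor (volume.map L.toContinuousLinearEquiv : Measure F)
    (volume : Measure F) with hc
  have hcpos : 0 < c := Measure.addHaarScalarFactor_pos_of_isAddHaarMeasure _ _
  have hme : MeasurableEmbedding (L.toContinuousLinearEquiv : E → F) :=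
    L.toContinuousLinearEquiv.toHomeomorph.measurableEmbedding
  refine ⟨c, by exact_mod_cast hcpos, fun g => ?_, fun g => ?_⟩
  · have := hme.integral_map (μ := volume) g
    rw [h1, integral_smul_nnreal_measure] at this
    rw [NNReal.smul_def, Complex.real_smul] at this
    exact this.symm
  · have := hme.integrable_map_iff (μ := volume) (g := g)
    rw [h1] at this
    have h2 : Integrable g (c • (volume : Measure F)) ↔ Integrable g := by
      have : (c : ENNReal) ≠ 0 := by exact_mod_cast hcpos.ne'
      exact integrable_smul_measure this ENNReal.coe_ne_top
    rw [← h2, this]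
    rfl

/-- The sign of the Minkowski metric. -/
noncomputable def mEps (μ : Fin 4) : ℝ := if μ = 0 then 1 else -1

lemma mEps_sq (μ : Fin 4) : mEps μ * mEps μ = 1 := by
  unfold mEps; split_ifs <;> norm_num

lemma mEps_sq' (μ : Fin 4) : mEps μ ^ 2 = 1 := by rw [sq, mEps_sq]

lemma mink_eq (k x : Fin 4 → ℝ) : mink k x = ∑ μ, mEps μ * k μ * x μ := by
  simp only [mink, Fin.sum_univ_four, mEps]
  simp
  ring

noncomputable def gaussS (m : ℕ) : ℝ := 1 / (Real.sqrt (m + 1) + 1)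

lemma gaussS_rel (m : ℕ) : gaussS m * 2 + m * gaussS m ^ 2 = 1 := by
  unfold gaussS
  have h : Real.sqrt (m + 1 : ℝ) ^ 2 = m + 1 := Real.sq_sqrt (by positivity)
  have h0 : 0 ≤ Real.sqrt (m + 1 : ℝ) := Real.sqrt_nonneg _
  set r := Real.sqrt (m + 1 : ℝ)
  have hm : (m : ℝ) = r ^ 2 - 1 := by linarith
  rw [hm]
  field_simp
  ring

/-- shear used to diagonalise the Gaussian -/
noncomputable def gaussMap (m : ℕ) : (Fin m × Fin 4 → ℝ) →ₗ[ℝ] (Fin m → Fin 4 → ℝ) where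
  toFun u j μ := u (j, μ) + gaussS m * ∑ l, u (l, μ)
  map_add' u v := by
    ext j μ; simp [Finset.sum_add_distrib]; ring
  map_smul' r u := by
    ext j μ; simp [← Finset.mul_sum]; ring

lemma gauss_sq (m : ℕ) (u : Fin m → ℝ) :
    ∑ j, (u j + gaussS m * ∑ l, u l) ^ 2 = ∑ j, u j ^ 2 + (∑ l, u l) ^ 2 := by
  have h := gaussS_rel m
  set U := ∑ l, u l with hU
  have : ∀ j, (u j + gaussS m * U) ^ 2 = u j ^ 2 + u j * (2 * gaussS m * U) + gaussS m ^ 2 * U ^ 2 :=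
    fun j => by ring
  simp_rw [this, Finset.sum_add_distrib, ← Finset.sum_mul, ← hU]
  simp
  linear_combination U ^ 2 * h

lemma gauss_sum (m : ℕ) (u : Fin m → ℝ) :
    (∑ j, (u j + gaussS m * ∑ l, u l)) ^ 2 = (m + 1) * (∑ l, u l) ^ 2 := by
  have h := gaussS_rel m
  rw [Finset.sum_add_distrib]
  simp
  set U := ∑ l, u l with hU
  linear_combination (m * U ^ 2) * h

lemma gauss_exp (m : ℕ) (u : Fin m → ℝ) :
    ∑ j, (u j + gaussS m * ∑ l, u l) ^ 2 - 1 / ((m : ℝ) + 1) * (∑ j, (u j + gaussS m * ∑ l, u l)) ^ 2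
      = ∑ j, u j ^ 2 := by
  rw [gauss_sq, gauss_sum]
  have : (m : ℝ) + 1 ≠ 0 := by positivity
  field_simp
  ring

lemma gaussMap_inj (m : ℕ) : Function.Injective (gaussMap m) := by
  rw [← LinearMap.ker_eq_bot, LinearMap.ker_eq_bot']
  intro u hu
  ext ⟨j, μ⟩
  have h1 := gauss_exp m (fun l => u (l, μ))
  have h2 : ∀ j, u (j, μ) + gaussS m * ∑ l, u (l, μ) = 0 := fun j => congrFun (congrFun hu j) μ
  simp only [h2] at h1
  simp at h1
  have := (Finset.sum_eq_zero_iff_of_nonneg (fun i _ => sq_nonneg (u (i, μ)))).1 h1.symm j (by simp)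
  simpa using this

noncomputable def gaussEquiv (m : ℕ) : (Fin m × Fin 4 → ℝ) ≃ₗ[ℝ] (Fin m → Fin 4 → ℝ) :=
  LinearEquiv.ofInjectiveOfFinrankEq (gaussMap m) (gaussMap_inj m) (by
    simp [Module.finrank_pi_fintype])

lemma gaussEquiv_apply (m : ℕ) (u : Fin m × Fin 4 → ℝ) (j μ) :
    gaussEquiv m u j μ = u (j, μ) + gaussS m * ∑ l, u (l, μ) := rfl

/-- momentum Gaussian in difference variables -/
noncomputable def gG (m : ℕ) (p : Fin m → Fin 4 → ℝ) : ℝ :=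
  Real.exp (-(1/2) * ∑ μ : Fin 4, (∑ j, (p j μ) ^ 2 - 1 / ((m : ℝ) + 1) * (∑ j, p j μ) ^ 2))

/-- position Gaussian -/
noncomputable def gE (m : ℕ) (a : Fin m → Fin 4 → ℝ) : ℝ :=
  Real.exp (-(1/2) * ((∑ j, ∑ μ : Fin 4, (a j μ) ^ 2) + ∑ μ : Fin 4, (∑ j, a j μ) ^ 2))

lemma gG_equiv (m : ℕ) (u : Fin m × Fin 4 → ℝ) :
    gG m (gaussEquiv m u) = Real.exp (-(1/2) * ∑ i, u i ^ 2) := by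
  unfold gG
  simp only [gaussEquiv_apply]
  simp only [gauss_exp m (fun l => u (l, _))]
  rw [Fintype.sum_prod_type, Finset.sum_comm]

lemma gG_integrable (m : ℕ) : Integrable (fun p => (gG m p : ℂ)) := by
  obtain ⟨c, hc, -, h⟩ := lin_cov (gaussEquiv m)
  rw [← h]
  have := GaussianFourier.integrable_cexp_neg_mul_sum_add (b := 1/2) (by norm_num)
    (fun _ : Fin m × Fin 4 => 0)
  refine this.congr (Filter.Eventually.of_forall fun u => ?_)
  simp only [gG_equiv]
  push_cast
  simp

lemma gauss_fourier (m : ℕ) : ∃ c : ℝ, 0 < c ∧ ∀ a : Fin m → Fin 4 → ℝ,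
    ∫ p, (gG m p : ℂ) * Complex.exp (-Complex.I * ((∑ j, mink (p j) (a j) : ℝ) : ℂ))
      = c * (gE m a : ℂ) := by
  obtain ⟨c, hc, h, -⟩ := lin_cov (gaussEquiv m)
  refine ⟨c⁻¹ * ((2 * Real.pi) ^ ((Fintype.card (Fin m × Fin 4) : ℝ) / 2)), by positivity,
    fun a => ?_⟩
  have h1 := h (fun p => (gG m p : ℂ) * Complex.exp (-Complex.I * ((∑ j, mink (p j) (a j) : ℝ) : ℂ)))
  have hc' : (c : ℂ) ≠ 0 := by exact_mod_cast hc.ne'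
  rw [← mul_right_inj' hc', ← h1]
  have h2 := GaussianFourier.integral_cexp_neg_mul_sum_add (b := 1/2) (by norm_num)
    (fun i : Fin m × Fin 4 => -Complex.I * ((mEps i.2 * (a i.1 i.2 + gaussS m * ∑ l, a l i.2) : ℝ) : ℂ))
  have h3 : ∀ u : Fin m × Fin 4 → ℝ, ∑ j, mink (gaussEquiv m u j) (a j) =
      ∑ i, mEps i.2 * (a i.1 i.2 + gaussS m * ∑ l, a l i.2) * u i := by
    intro u
    simp only [mink_eq, gaussEquiv_apply]
    rw [Fintype.sum_prod_type, Finset.sum_comm]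
    conv_rhs => rw [Finset.sum_comm]
    refine Finset.sum_congr rfl fun μ _ => ?_
    simp only [mul_add, add_mul, Finset.sum_add_distrib]
    congr 1
    · exact Finset.sum_congr rfl fun j _ => by ring
    · have e1 : ∀ j, mEps μ * (gaussS m * ∑ l, u (l, μ)) * a j μ =
        (mEps μ * gaussS m * ∑ l, u (l, μ)) * a j μ := fun j => by ring
      have e2 : ∀ j, mEps μ * (gaussS m * ∑ l, a l μ) * u (j, μ) =
        (mEps μ * gaussS m * ∑ l, a l μ) * u (j, μ) := fun j => by ring
      simp_rw [e1, e2, ← Finset.mul_sum]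
      ring
  calc _ = ∫ v : Fin m × Fin 4 → ℝ, Complex.exp (-(1/2) * ∑ i, (v i : ℂ) ^ 2 + ∑ i,
        (-Complex.I * ((mEps i.2 * (a i.1 i.2 + gaussS m * ∑ l, a l i.2) : ℝ) : ℂ)) * v i) := by
        refine integral_congr_ae (Filter.Eventually.of_forall fun u => ?_)
        simp only [gG_equiv, h3]
        rw [Complex.ofReal_exp, ← Complex.exp_add]
        congr 1
        push_cast
        rw [Finset.mul_sum (a := -Complex.I)]
        simp only [mul_assoc]
    _ = _ := by
        rw [h2]
        have e : (∑ i : Fin m × Fin 4, (-Complex.I * ((mEps i.2 * (a i.1 i.2 + gaussS m * ∑ l, a l i.2) : ℝ) : ℂ)) ^ 2)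
          / (4 * (1/2)) = ((-(1/2) * ((∑ j, ∑ μ : Fin 4, (a j μ) ^ 2) + ∑ μ : Fin 4, (∑ j, a j μ) ^ 2) : ℝ) : ℂ) := by
          have e3 : ∀ i : Fin m × Fin 4, (-Complex.I * ((mEps i.2 * (a i.1 i.2 + gaussS m * ∑ l, a l i.2) : ℝ) : ℂ)) ^ 2
            = ((- (a i.1 i.2 + gaussS m * ∑ l, a l i.2) ^ 2 : ℝ) : ℂ) := by
            intro i
            rw [mul_pow, neg_sq, Complex.I_sq, ← Complex.ofReal_pow, mul_pow, mEps_sq']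
            push_cast; ring
          simp_rw [e3]
          rw [← Complex.ofReal_sum, Finset.sum_neg_distrib, Fintype.sum_prod_type, Finset.sum_comm]
          simp only [gauss_sq m (fun l => a l _)]
          rw [Finset.sum_add_distrib, Finset.sum_comm]
          push_cast
          ring
        rw [e, ← Complex.ofReal_exp]
        rw [show (Real.pi : ℂ) / (1/2) = ((2 * Real.pi : ℝ) : ℂ) by push_cast; ring]
        rw [show ((Fintype.card (Fin m × Fin 4) : ℂ) / 2) = (((Fintype.card (Fin m × Fin 4) : ℝ) / 2 : ℝ) : ℂ) by push_cast; ring]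
        rw [← Complex.ofReal_cpow (by positivity)]
        push_cast [gE]
        field_simp

lemma gE_le (m : ℕ) (a : Fin m → Fin 4 → ℝ) : gE m a ≤ 1 := by
  unfold gE
  rw [Real.exp_le_one_iff]
  have : 0 ≤ (∑ j, ∑ μ : Fin 4, (a j μ) ^ 2) + ∑ μ : Fin 4, (∑ j, a j μ) ^ 2 := by positivity
  linarith

lemma gG_le (m : ℕ) (p : Fin m → Fin 4 → ℝ) : gG m p ≤ 1 := by
  obtain ⟨u, rfl⟩ := (gaussEquiv m).surjective p
  rw [gG_equiv, Real.exp_le_one_iff]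
  have : 0 ≤ ∑ i, u i ^ 2 := by positivity
  linarith

lemma gE_continuous (m : ℕ) : Continuous (gE m) := by unfold gE; fun_prop

lemma gG_continuous (m : ℕ) : Continuous (gG m) := by unfold gG; fun_prop

noncomputable def curryEquiv (m : ℕ) : (Fin m × Fin 4 → ℝ) ≃ₗ[ℝ] (Fin m → Fin 4 → ℝ) :=
  LinearEquiv.curry ℝ ℝ (Fin m) (Fin 4)

lemma gE_integrable (m : ℕ) : Integrable (fun a => (gE m a : ℂ)) := by
  obtain ⟨c, hc, -, h⟩ := lin_cov (curryEquiv m)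
  rw [← h]
  have := GaussianFourier.integrable_cexp_neg_mul_sum_add (b := 1/2) (by norm_num)
    (fun _ : Fin m × Fin 4 => 0)
  refine this.mono ?_ (Filter.Eventually.of_forall fun u => ?_)
  · apply Continuous.aestronglyMeasurable
    have := gE_continuous m
    have h2 : Continuous (curryEquiv m) := (curryEquiv m).toContinuousLinearEquiv.continuous
    fun_prop
  · have e : Complex.exp (-(1/2) * ∑ i, (u i : ℂ) ^ 2 + ∑ i, 0 * (u i : ℂ)) =
      ((Real.exp (-(1/2) * ∑ i, u i ^ 2) : ℝ) : ℂ) := by push_cast; simp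
    rw [e, Complex.norm_real, Complex.norm_real, Real.norm_of_nonneg (Real.exp_pos _).le]
    unfold gE
    rw [Real.norm_of_nonneg (Real.exp_pos _).le]
    apply Real.exp_le_exp.2
    rw [Fintype.sum_prod_type]
    have : 0 ≤ ∑ μ : Fin 4, (∑ j, (curryEquiv m u) j μ) ^ 2 := by positivity
    simp only [show ∀ j μ, curryEquiv m u j μ = u (j, μ) from fun _ _ => rfl] at this ⊢
    linarith

lemma piHaar (m : ℕ) : (volume : Measure (Fin m → Fin 4 → ℝ)).IsAddHaarMeasure :=
  Measure.pi.isAddHaarMeasure (fun _ : Fin m => (volume : Measure (Fin 4 → ℝ)))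

lemma prodHaar (m : ℕ) :
    (volume : Measure ((Fin m → Fin 4 → ℝ) × (Fin 4 → ℝ))).IsAddHaarMeasure := by
  have := piHaar m
  rw [Measure.volume_eq_prod]
  exact Measure.prod.instIsAddHaarMeasure _ _

lemma norm_cexp_neg (r : ℝ) : ‖Complex.exp (-Complex.I * (r : ℂ))‖ = 1 := by
  have := Complex.norm_exp_I_mul_ofReal (-r)
  rw [← this]; congr 2; push_cast; ring

/-- Scaled coordinates on Euclidean space. -/
noncomputable def scaleEquiv {ι : Type*} [Fintype ι] (s : ι → ℝ) (hs : ∀ i, s i ≠ 0) :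
    EuclideanSpace ℝ ι ≃ₗ[ℝ] (ι → ℝ) :=
  (WithLp.linearEquiv 2 ℝ (ι → ℝ)).trans
    (LinearEquiv.piCongrRight fun i => LinearEquiv.smulOfNeZero ℝ ℝ (s i) (hs i))

lemma scaleEquiv_apply {ι : Type*} [Fintype ι] (s : ι → ℝ) (hs : ∀ i, s i ≠ 0)
    (v : EuclideanSpace ℝ ι) (i : ι) : scaleEquiv s hs v i = s i * v i := rfl

lemma mEps_ne (μ : Fin 4) : 2 * Real.pi * mEps μ ≠ 0 := by
  have : mEps μ ≠ 0 := by unfold mEps; split_ifs <;> norm_num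
  have := Real.pi_ne_zero
  positivity

lemma mink_scale (w v : EuclideanSpace ℝ (Fin 4)) :
    mink (scaleEquiv (fun μ => 2 * Real.pi * mEps μ) mEps_ne w) (WithLp.linearEquiv 2 ℝ _ v)
      = 2 * Real.pi * inner ℝ v w := by
  rw [mink_eq, PiLp.inner_apply, Finset.mul_sum]
  refine Finset.sum_congr rfl fun μ _ => ?_
  rw [scaleEquiv_apply]
  simp
  linear_combination (2 * Real.pi * v μ * w μ) * mEps_sq μ

lemma inv4 : ∃ c : ℝ, 0 < c ∧ ∀ h : (Fin 4 → ℝ) → ℂ, Continuous h → Integrable h →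
    Integrable (fun q : Fin 4 → ℝ => ∫ b, h b * Complex.exp (-Complex.I * ((mink q b : ℝ) : ℂ))) →
    ∀ x, (∫ q : Fin 4 → ℝ, (∫ b, h b * Complex.exp (-Complex.I * ((mink q b : ℝ) : ℂ))) *
      Complex.exp (Complex.I * ((mink q x : ℝ) : ℂ))) = c * h x := by
  let e : EuclideanSpace ℝ (Fin 4) ≃ₗ[ℝ] (Fin 4 → ℝ) := WithLp.linearEquiv 2 ℝ _
  let M := scaleEquiv (fun μ : Fin 4 => 2 * Real.pi * mEps μ) mEps_ne
  obtain ⟨c1, hc1, h1, h1i⟩ := lin_cov e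
  obtain ⟨c2, hc2, h2, h2i⟩ := lin_cov M
  refine ⟨(c1 * c2)⁻¹, by positivity, fun h hcont hIntg hhat x => ?_⟩
  set hh : (Fin 4 → ℝ) → ℂ := fun q => ∫ b, h b * Complex.exp (-Complex.I * ((mink q b : ℝ) : ℂ))
    with hhdef
  have hF : ∀ w, FourierTransform.fourier (fun v => h (e v)) w = c1 * hh (M w) := by
    intro w
    rw [Real.fourier_eq', hhdef]
    rw [← h1]
    refine integral_congr_ae (Filter.Eventually.of_forall fun v => ?_)
    simp only [smul_eq_mul]
    rw [mink_scale w v, mul_comm]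
    congr 2
    push_cast; ring
  have hF' : FourierTransform.fourier (fun v => h (e v)) = fun w => c1 * hh (M w) := funext hF
  have hg : Continuous (fun v => h (e v)) :=
    hcont.comp e.toContinuousLinearEquiv.continuous
  have key := Continuous.fourierInv_fourier_eq hg ((h1i h).2 hIntg)
    (by rw [hF']; exact ((h2i hh).2 hhat).const_mul _)
  have key2 := congrFun key (e.symm x)
  simp only [LinearEquiv.apply_symm_apply] at key2
  rw [← key2, Real.fourierInv_eq', hF']
  have e2 := h2 (fun q => hh q * Complex.exp (Complex.I * ((mink q x : ℝ) : ℂ)))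
  have e3 : (∫ v : EuclideanSpace ℝ (Fin 4), Complex.exp (↑(2 * Real.pi * inner ℝ v (e.symm x)) * Complex.I) • (c1 * hh (M v)))
     = c1 * ∫ w, hh (M w) * Complex.exp (Complex.I * ((mink (M w) x : ℝ) : ℂ)) := by
    rw [← integral_const_mul]
    refine integral_congr_ae (Filter.Eventually.of_forall fun v => ?_)
    simp only [smul_eq_mul]
    have := mink_scale v (e.symm x)
    rw [show (WithLp.linearEquiv 2 ℝ (Fin 4 → ℝ)) (e.symm x) = x from e.apply_symm_apply x] at this
    rw [this, real_inner_comm]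
    rw [mul_comm (Complex.I)]
    ring
  rw [e3, e2]
  change (∫ q, hh q * Complex.exp (Complex.I * ((mink q x : ℝ) : ℂ))) = _
  generalize (∫ q, hh q * Complex.exp (Complex.I * ((mink q x : ℝ) : ℂ))) = J
  have : (c1 : ℂ) ≠ 0 := by exact_mod_cast hc1.ne'
  have : (c2 : ℂ) ≠ 0 := by exact_mod_cast hc2.ne'
  push_cast
  field_simp

lemma invFT_integrable {n : ℕ} (f : SchwartzMap (Fin n → Fin 4 → ℝ) ℂ) : Integrable (invFT f) := by
  let e : EuclideanSpace ℝ (Fin n × Fin 4) ≃ₗ[ℝ] (Fin n → Fin 4 → ℝ) :=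
    (WithLp.linearEquiv 2 ℝ _).trans (curryEquiv n)
  let M : EuclideanSpace ℝ (Fin n × Fin 4) ≃ₗ[ℝ] (Fin n → Fin 4 → ℝ) :=
    (scaleEquiv (fun i : Fin n × Fin 4 => 2 * Real.pi * mEps i.2) (fun i => mEps_ne i.2)).trans
    (curryEquiv n)
  obtain ⟨c1, hc1, h1, h1i⟩ := lin_cov e
  obtain ⟨c2, hc2, h2, h2i⟩ := lin_cov M
  rw [← h2i]
  let g : SchwartzMap (EuclideanSpace ℝ (Fin n × Fin 4)) ℂ :=
    SchwartzMap.compCLMOfContinuousLinearEquiv ℂ e.toContinuousLinearEquiv f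
  have hgi := (FourierTransform.fourier g).integrable (μ := volume)
  have hc1' : (c1 : ℂ) ≠ 0 := by exact_mod_cast hc1.ne'
  refine (hgi.const_mul ((((2 * Real.pi) ^ (4 * n) : ℝ)⁻¹ : ℂ) * (c1 : ℂ)⁻¹)).congr
    (Filter.Eventually.of_forall fun w => ?_)
  simp only [SchwartzMap.fourier_coe]
  rw [Real.fourier_eq', invFT, mul_assoc]
  congr 1
  rw [inv_mul_eq_iff_eq_mul₀ hc1', ← h1]
  refine integral_congr_ae (Filter.Eventually.of_forall fun v => ?_)
  simp only [smul_eq_mul]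
  have : ∑ j, mink (M w j) (e v j) = 2 * Real.pi * inner ℝ v w := by
    rw [PiLp.inner_apply, Finset.mul_sum, Fintype.sum_prod_type]
    refine Finset.sum_congr rfl fun j _ => ?_
    rw [mink_eq]
    refine Finset.sum_congr rfl fun μ _ => ?_
    have a1 : M w j μ = 2 * Real.pi * mEps μ * w (j, μ) := rfl
    have a2 : e v j μ = v (j, μ) := rfl
    rw [a1, a2]
    simp
    linear_combination (2 * Real.pi * v (j, μ) * w (j, μ)) * mEps_sq μ
  rw [this, mul_comm]
  have a3 : g v = f (e v) := rfl
  rw [a3]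
  congr 2
  push_cast; ring

/-- momentum difference variables -/
noncomputable def diffMap (m : ℕ) :
    (Fin (m + 1) → Fin 4 → ℝ) →ₗ[ℝ] (Fin m → Fin 4 → ℝ) × (Fin 4 → ℝ) where
  toFun k := (fun j => k j.castSucc - k (Fin.last m), ∑ j, k j)
  map_add' k l := by
    ext <;> simp [Finset.sum_add_distrib]; ring
  map_smul' r k := by
    ext <;> simp [← Finset.mul_sum]; ring

lemma diffMap_inj (m : ℕ) : Function.Injective (diffMap m) := by
  rw [← LinearMap.ker_eq_bot, LinearMap.ker_eq_bot']
  intro k hk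
  have h1 : ∀ j : Fin m, k j.castSucc = k (Fin.last m) := fun j =>
    sub_eq_zero.1 (congrFun (congrArg Prod.fst hk) j)
  have h2 : ∑ j, k j = 0 := congrArg Prod.snd hk
  rw [Fin.sum_univ_castSucc] at h2
  simp only [h1] at h2
  have h3 : k (Fin.last m) = 0 := by
    ext μ
    have := congrFun h2 μ
    simp at this
    have h4 : ((m : ℝ) + 1) * k (Fin.last m) μ = 0 := by linarith
    have h5 : (m : ℝ) + 1 ≠ 0 := by positivity
    simpa [h5] using h4
  ext j
  induction j using Fin.lastCases with
  | last => rw [h3]; rfl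
  | cast j => rw [h1, h3]; rfl

noncomputable def diffEquiv (m : ℕ) :
    (Fin (m + 1) → Fin 4 → ℝ) ≃ₗ[ℝ] (Fin m → Fin 4 → ℝ) × (Fin 4 → ℝ) :=
  LinearEquiv.ofInjectiveOfFinrankEq (diffMap m) (diffMap_inj m) (by
    simp [Module.finrank_pi_fintype]; ring)

lemma diagShift_castSucc (m : ℕ) (x : Fin 4 → ℝ) (a : Fin m → Fin 4 → ℝ) (j : Fin m) :
    diagShift (m + 1) x a j.castSucc = x + a j := by
  simp [diagShift]

lemma diagShift_last (m : ℕ) (x : Fin 4 → ℝ) (a : Fin m → Fin 4 → ℝ) :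
    diagShift (m + 1) x a (Fin.last m) = x - ∑ i, a i := by
  simp [diagShift]

noncomputable def shiftMap (m : ℕ) :
    (Fin m → Fin 4 → ℝ) × (Fin 4 → ℝ) →ₗ[ℝ] (Fin (m + 1) → Fin 4 → ℝ) where
  toFun z := diagShift (m + 1) z.2 z.1
  map_add' z w := by
    ext j μ
    induction j using Fin.lastCases with
    | last => simp only [Pi.add_apply, diagShift_last]; simp [Finset.sum_add_distrib]; ring
    | cast j => simp only [Pi.add_apply, diagShift_castSucc]; simp; ring
  map_smul' r w := by
    ext j μ
    induction j using Fin.lastCases with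
    | last => simp only [Pi.smul_apply, diagShift_last]; simp [← Finset.mul_sum]; ring
    | cast j => simp only [Pi.smul_apply, diagShift_castSucc]; simp; ring

lemma shiftMap_inj (m : ℕ) : Function.Injective (shiftMap m) := by
  rw [← LinearMap.ker_eq_bot, LinearMap.ker_eq_bot']
  rintro ⟨a, b⟩ hk
  have h1 : ∀ j : Fin m, b + a j = 0 := fun j => by
    rw [← diagShift_castSucc m b a j]; exact congrFun hk j.castSucc
  have h2 : b - ∑ i, a i = 0 := by
    rw [← diagShift_last m b a]; exact congrFun hk (Fin.last m)
  have h3 : ∀ j, a j = -b := fun j => (neg_eq_of_add_eq_zero_right (h1 j)).symm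
  have h4 : b = 0 := by
    ext μ
    have := congrFun h2 μ
    simp [h3] at this
    have h4 : ((m : ℝ) + 1) * b μ = 0 := by linarith
    have h5 : (m : ℝ) + 1 ≠ 0 := by positivity
    simpa [h5] using h4
  refine Prod.ext ?_ h4
  ext j : 1
  change a j = 0
  rw [h3, h4]; simp

noncomputable def shiftEquiv (m : ℕ) :
    ((Fin m → Fin 4 → ℝ) × (Fin 4 → ℝ)) ≃ₗ[ℝ] (Fin (m + 1) → Fin 4 → ℝ) :=
  LinearEquiv.ofInjectiveOfFinrankEq (shiftMap m) (shiftMap_inj m) (by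
    simp [Module.finrank_pi_fintype]; ring)

lemma shiftEquiv_apply (m : ℕ) (z) : shiftEquiv m z = diagShift (m + 1) z.2 z.1 := rfl

lemma diffEquiv_apply (m : ℕ) (k) :
    diffEquiv m k = (fun j => k j.castSucc - k (Fin.last m), ∑ j, k j) := rfl

lemma regKernel_eq (m : ℕ) (k : Fin (m + 1) → Fin 4 → ℝ) :
    regKernel (m + 1) k = gG m (diffEquiv m k).1 := by
  unfold regKernel gG
  rw [diffEquiv_apply]
  congr 2
  refine Finset.sum_congr rfl fun μ _ => ?_
  simp only [Pi.sub_apply]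
  rw [← Finset.sum_mul_sum, Fin.sum_univ_castSucc, Fin.sum_univ_castSucc (fun j => k j μ)]
  set κ := k (Fin.last m) μ
  have e : ∀ j : Fin m, (k j.castSucc μ - κ) ^ 2 = k j.castSucc μ ^ 2 - k j.castSucc μ * (2 * κ) + κ ^ 2 :=
    fun j => by ring
  simp_rw [e]
  rw [Finset.sum_add_distrib, Finset.sum_sub_distrib, Finset.sum_sub_distrib, ← Finset.sum_mul]
  simp
  have h5 : (m : ℝ) + 1 ≠ 0 := by positivity
  field_simp
  ring

lemma pairing_eq (m : ℕ) (k : Fin (m + 1) → Fin 4 → ℝ) (z : (Fin m → Fin 4 → ℝ) × (Fin 4 → ℝ)) :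
    ∑ j, mink (k j) (shiftEquiv m z j) =
      (∑ j, mink ((diffEquiv m k).1 j) (z.1 j)) + mink (diffEquiv m k).2 z.2 := by
  rw [shiftEquiv_apply, diffEquiv_apply]
  simp only [mink_eq]
  rw [Finset.sum_comm, Finset.sum_comm (s := Finset.univ (α := Fin m)), ← Finset.sum_add_distrib]
  refine Finset.sum_congr rfl fun μ _ => ?_
  rw [Fin.sum_univ_castSucc, Fin.sum_univ_castSucc]
  simp only [diagShift_castSucc, diagShift_last, Pi.add_apply, Pi.sub_apply, Finset.sum_apply]
  simp only [mul_add, add_mul, mul_sub, sub_mul, Finset.sum_add_distrib, Finset.sum_sub_distrib,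
    Finset.mul_sum, Finset.sum_mul]
  ring

lemma mink_continuous {T : Type*} [TopologicalSpace T] {u v : T → Fin 4 → ℝ}
    (hu : Continuous u) (hv : Continuous v) : Continuous (fun t => mink (u t) (v t)) := by
  unfold mink; fun_prop

/-- Fourier transform in the adapted variables. -/
noncomputable def phiT (m : ℕ) (F : (Fin m → Fin 4 → ℝ) × (Fin 4 → ℝ) → ℂ)
    (w : (Fin m → Fin 4 → ℝ) × (Fin 4 → ℝ)) : ℂ :=
  ∫ z : (Fin m → Fin 4 → ℝ) × (Fin 4 → ℝ), F z *
    Complex.exp (-Complex.I * (((∑ j, mink (w.1 j) (z.1 j)) + mink w.2 z.2 : ℝ) : ℂ))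

lemma norm_gG_le (m : ℕ) (p) : ‖(gG m p : ℂ)‖ ≤ 1 := by
  rw [Complex.norm_real, Real.norm_of_nonneg (show 0 ≤ gG m p from (Real.exp_pos _).le)]; exact gG_le m p

lemma norm_gE_le (m : ℕ) (p) : ‖(gE m p : ℂ)‖ ≤ 1 := by
  rw [Complex.norm_real, Real.norm_of_nonneg (show 0 ≤ gE m p from (Real.exp_pos _).le)]; exact gE_le m p

lemma core_aux (m : ℕ) (cG : ℝ)
    (hG : ∀ a : Fin m → Fin 4 → ℝ,
      ∫ p, (gG m p : ℂ) * Complex.exp (-Complex.I * ((∑ j, mink (p j) (a j) : ℝ) : ℂ))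
      = cG * (gE m a : ℂ))
    (F : (Fin m → Fin 4 → ℝ) × (Fin 4 → ℝ) → ℂ) (hFi : Integrable F) (q : Fin 4 → ℝ) :
    ∫ p, phiT m F (p, q) * (gG m p : ℂ) =
      cG * ∫ b, (∫ a, F (a, b) * (gE m a : ℂ)) *
        Complex.exp (-Complex.I * ((mink q b : ℝ) : ℂ)) := by
  have hGc := gG_continuous m
  have hEc := gE_continuous m
  have e1 : ∀ p, phiT m F (p, q) * (gG m p : ℂ) =
      ∫ z : (Fin m → Fin 4 → ℝ) × (Fin 4 → ℝ), ((gG m p : ℂ) * F z) *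
        Complex.exp (-Complex.I * (((∑ j, mink (p j) (z.1 j)) + mink q z.2 : ℝ) : ℂ)) := by
    intro p
    unfold phiT
    rw [mul_comm, ← integral_const_mul]
    simp only [mul_assoc]
  simp_rw [e1]
  rw [integral_integral_swap]
  · have e2 : ∀ z : (Fin m → Fin 4 → ℝ) × (Fin 4 → ℝ),
        ∫ p, ((gG m p : ℂ) * F z) *
        Complex.exp (-Complex.I * (((∑ j, mink (p j) (z.1 j)) + mink q z.2 : ℝ) : ℂ)) =
        cG * ((F z * (gE m z.1 : ℂ)) * Complex.exp (-Complex.I * ((mink q z.2 : ℝ) : ℂ))) := by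
      intro z
      have : ∀ p, ((gG m p : ℂ) * F z) *
        Complex.exp (-Complex.I * (((∑ j, mink (p j) (z.1 j)) + mink q z.2 : ℝ) : ℂ)) =
        (F z * Complex.exp (-Complex.I * ((mink q z.2 : ℝ) : ℂ))) *
        ((gG m p : ℂ) * Complex.exp (-Complex.I * ((∑ j, mink (p j) (z.1 j) : ℝ) : ℂ))) := by
        intro p
        rw [Complex.ofReal_add, mul_add, Complex.exp_add]
        ring
      simp_rw [this]
      rw [integral_const_mul, hG]
      ring
    simp_rw [e2]
    rw [integral_const_mul]
    congr 1
    rw [Measure.volume_eq_prod, integral_prod_symm]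
    · refine integral_congr_ae (Filter.Eventually.of_forall fun b => ?_)
      simp only [integral_mul_const]
    · refine Integrable.mul_bdd (c := 1) (Integrable.mul_bdd (c := 1) hFi ?_ ?_) ?_ ?_
      · exact Continuous.aestronglyMeasurable (by fun_prop)
      · exact Filter.Eventually.of_forall fun z => norm_gE_le m _
      · have := mink_continuous (T := (Fin m → Fin 4 → ℝ) × (Fin 4 → ℝ))
          (u := fun _ => q) (v := fun z => z.2) (by fun_prop) (by fun_prop)
        exact Continuous.aestronglyMeasurable (by fun_prop)
      · exact Filter.Eventually.of_forall fun z => (norm_cexp_neg _).le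
  · refine Integrable.mul_bdd (c := 1) ((gG_integrable m).mul_prod hFi) ?_ ?_
    · have h1 : ∀ j, Continuous (fun z : (Fin m → Fin 4 → ℝ) × ((Fin m → Fin 4 → ℝ) × (Fin 4 → ℝ)) =>
          mink (z.1 j) (z.2.1 j)) := fun j => mink_continuous (by fun_prop) (by fun_prop)
      have h2 : Continuous (fun z : (Fin m → Fin 4 → ℝ) × ((Fin m → Fin 4 → ℝ) × (Fin 4 → ℝ)) =>
          mink q z.2.2) := mink_continuous (by fun_prop) (by fun_prop)
      exact Continuous.aestronglyMeasurable (by fun_prop)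
    · exact Filter.Eventually.of_forall fun z => (norm_cexp_neg _).le

lemma core (m : ℕ) : ∃ c : ℝ, 0 < c ∧
    ∀ F : (Fin m → Fin 4 → ℝ) × (Fin 4 → ℝ) → ℂ, Continuous F → Integrable F →
      ∀ C : ℝ, (∀ z, ‖F z‖ ≤ C) → Integrable (phiT m F) → ∀ x : Fin 4 → ℝ,
      Integrable (fun w : (Fin m → Fin 4 → ℝ) × (Fin 4 → ℝ) => phiT m F w * (gG m w.1 : ℂ) *
        Complex.exp (Complex.I * ((mink w.2 x : ℝ) : ℂ))) ∧
      Integrable (fun a => F (a, x) * (gE m a : ℂ)) ∧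
      ∫ w : (Fin m → Fin 4 → ℝ) × (Fin 4 → ℝ), phiT m F w * (gG m w.1 : ℂ) *
        Complex.exp (Complex.I * ((mink w.2 x : ℝ) : ℂ)) =
      c * ∫ a, F (a, x) * (gE m a : ℂ) := by
  obtain ⟨cG, hcG, hG⟩ := gauss_fourier m
  obtain ⟨c4, hc4, h4⟩ := inv4
  refine ⟨cG * c4, by positivity, fun F hFc hFi C hC hPhi x => ?_⟩
  have hGc := gG_continuous m
  have hEc := gE_continuous m
  have i1 : Integrable (fun w : (Fin m → Fin 4 → ℝ) × (Fin 4 → ℝ) =>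
      phiT m F w * (gG m w.1 : ℂ)) :=
    Integrable.mul_bdd (c := 1) hPhi (Continuous.aestronglyMeasurable (by fun_prop))
      (Filter.Eventually.of_forall fun z => norm_gG_le m _)
  have i2 : Integrable (fun w : (Fin m → Fin 4 → ℝ) × (Fin 4 → ℝ) => phiT m F w * (gG m w.1 : ℂ) *
        Complex.exp (Complex.I * ((mink w.2 x : ℝ) : ℂ))) := by
    refine Integrable.mul_bdd (c := 1) i1 ?_
      (Filter.Eventually.of_forall fun z => (Complex.norm_exp_I_mul_ofReal _).le)
    have := mink_continuous (T := (Fin m → Fin 4 → ℝ) × (Fin 4 → ℝ))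
          (u := fun z => z.2) (v := fun z => x) (by fun_prop) (by fun_prop)
    exact Continuous.aestronglyMeasurable (by fun_prop)
  have i3 : ∀ y, Integrable (fun a => F (a, y) * (gE m a : ℂ)) := fun y =>
    Integrable.bdd_mul (c := C) (gE_integrable m) (Continuous.aestronglyMeasurable (by fun_prop))
      (Filter.Eventually.of_forall fun z => hC _)
  refine ⟨i2, i3 x, ?_⟩
  set h : (Fin 4 → ℝ) → ℂ := fun b => ∫ a, F (a, b) * (gE m a : ℂ) with hdef
  have hcont : Continuous h := by
    refine continuous_of_dominated (bound := fun a => C * ‖(gE m a : ℂ)‖)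
      (fun y => (i3 y).1) (fun y => Filter.Eventually.of_forall fun a => ?_)
      ((gE_integrable m).norm.const_mul C) (Filter.Eventually.of_forall fun a => by fun_prop)
    rw [norm_mul]
    gcongr
    exact hC _
  have hIntg : Integrable h := by
    have : Integrable (fun z : (Fin m → Fin 4 → ℝ) × (Fin 4 → ℝ) => F z * (gE m z.1 : ℂ)) :=
      Integrable.mul_bdd (c := 1) hFi (Continuous.aestronglyMeasurable (by fun_prop))
      (Filter.Eventually.of_forall fun z => norm_gE_le m _)
    exact this.integral_prod_right
  have hcG' : (cG : ℂ) ≠ 0 := by exact_mod_cast hcG.ne'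
  have aux := core_aux m cG hG F hFi
  have hhat : Integrable (fun q : Fin 4 → ℝ => ∫ b, h b *
      Complex.exp (-Complex.I * ((mink q b : ℝ) : ℂ))) := by
    have := (i1.integral_prod_right).const_mul (cG : ℂ)⁻¹
    refine this.congr (Filter.Eventually.of_forall fun q => ?_)
    simp only [aux q]
    rw [inv_mul_cancel_left₀ hcG']
  have hfin := h4 h hcont hIntg hhat x
  rw [Measure.volume_eq_prod, integral_prod_symm _ i2]
  simp only [integral_mul_const, aux]
  simp_rw [mul_assoc (cG : ℂ)]
  rw [integral_const_mul]
  change (cG : ℂ) * (∫ q : Fin 4 → ℝ, (∫ b, h b * Complex.exp (-Complex.I * ((mink q b : ℝ) : ℂ))) *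
      Complex.exp (Complex.I * ((mink q x : ℝ) : ℂ))) = _
  rw [hfin]
  push_cast
  ring

lemma main_succ (m : ℕ) :
    ∃ c : ℝ, 0 < c ∧ ∀ (f : SchwartzMap (Fin (m + 1) → Fin 4 → ℝ) ℂ) (x : Fin 4 → ℝ),
      Integrable (fun k : Fin (m + 1) → Fin 4 → ℝ =>
        invFT f k * (regKernel (m + 1) k : ℂ) *
          Complex.exp (Complex.I * ((mink (∑ j, k j) x : ℝ) : ℂ))) ∧
      Integrable (fun a : Fin m → Fin 4 → ℝ =>
        f (diagShift (m + 1) x a) * (gE m a : ℂ)) ∧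
      (∫ k : Fin (m + 1) → Fin 4 → ℝ,
        invFT f k * (regKernel (m + 1) k : ℂ) *
          Complex.exp (Complex.I * ((mink (∑ j, k j) x : ℝ) : ℂ))) =
      (c : ℂ) * ∫ a : Fin m → Fin 4 → ℝ,
        f (diagShift (m + 1) x a) * (gE m a : ℂ) := by
  obtain ⟨c0, hc0, h0⟩ := core m
  have hHaar := prodHaar m
  have hHaar2 := piHaar (m + 1)
  obtain ⟨c1, hc1, h1, h1i⟩ := lin_cov (shiftEquiv m)
  obtain ⟨c2, hc2, h2, h2i⟩ := lin_cov (diffEquiv m)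
  set N : ℝ := ((2 * Real.pi) ^ (4 * (m + 1)))⁻¹ with hN
  have hNpos : 0 < N := by positivity
  have hc1' : (c1 : ℂ) ≠ 0 := by exact_mod_cast hc1.ne'
  have hN' : (N : ℂ) ≠ 0 := by exact_mod_cast hNpos.ne'
  refine ⟨N * c1⁻¹ * c2 * c0, by positivity, fun f x => ?_⟩
  have hphi : ∀ k, invFT f k = (N * (c1 : ℂ)⁻¹) * phiT m (fun z => f (shiftEquiv m z)) (diffEquiv m k) := by
    intro k
    have e := h1 (fun y => f y * Complex.exp (-Complex.I * ((∑ j, mink (k j) (y j) : ℝ) : ℂ)))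
    simp only [pairing_eq] at e
    have e' : phiT m (fun z => f (shiftEquiv m z)) (diffEquiv m k) = _ := e
    rw [e', mul_assoc, inv_mul_cancel_left₀ hc1', invFT, hN]
    push_cast
    rfl
  have hPi : Integrable (phiT m (fun z => f (shiftEquiv m z))) := by
    rw [← h2i]
    have := (invFT_integrable f).const_mul (N * (c1 : ℂ)⁻¹)⁻¹
    refine this.congr (Filter.Eventually.of_forall fun k => ?_)
    simp only [hphi k]
    rw [inv_mul_cancel_left₀]
    exact mul_ne_zero hN' (inv_ne_zero hc1')
  obtain ⟨r1, r2, r3⟩ := h0 (fun z => f (shiftEquiv m z))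
    (f.continuous.comp (shiftEquiv m).toContinuousLinearEquiv.continuous)
    ((h1i f).2 f.integrable) (SchwartzMap.seminorm ℂ 0 0 f)
    (fun z => SchwartzMap.norm_le_seminorm ℂ f _) hPi x
  have hfun : (fun k : Fin (m + 1) → Fin 4 → ℝ => invFT f k * (regKernel (m + 1) k : ℂ) *
          Complex.exp (Complex.I * ((mink (∑ j, k j) x : ℝ) : ℂ))) =
      fun k => (N * (c1 : ℂ)⁻¹) * (fun w : (Fin m → Fin 4 → ℝ) × (Fin 4 → ℝ) =>
        phiT m (fun z => f (shiftEquiv m z)) w * (gG m w.1 : ℂ) *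
        Complex.exp (Complex.I * ((mink w.2 x : ℝ) : ℂ))) (diffEquiv m k) := by
    funext k
    rw [hphi, regKernel_eq]
    simp only [show (diffEquiv m k).2 = ∑ j, k j from rfl]
    ring
  refine ⟨?_, r2, ?_⟩
  · rw [hfun]
    exact ((h2i _).2 r1).const_mul _
  · rw [hfun, integral_const_mul, h2 (fun w : (Fin m → Fin 4 → ℝ) × (Fin 4 → ℝ) =>
        phiT m (fun z => f (shiftEquiv m z)) w * (gG m w.1 : ℂ) *
        Complex.exp (Complex.I * ((mink w.2 x : ℝ) : ℂ))), r3]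
    simp only [shiftEquiv_apply]
    push_cast
    ring

theorem quantum_diagonal_map_configuration_space_kernel (n : ℕ) (hn : 2 ≤ n) :
    ∃ c : ℝ, 0 < c ∧ ∀ (f : SchwartzMap (Fin n → Fin 4 → ℝ) ℂ) (x : Fin 4 → ℝ),
      Integrable (fun k : Fin n → Fin 4 → ℝ =>
        invFT f k * (regKernel n k : ℂ) *
          Complex.exp (Complex.I * ((mink (∑ j, k j) x : ℝ) : ℂ))) ∧
      Integrable (fun a : Fin (n - 1) → Fin 4 → ℝ =>
        f (diagShift n x a) *
          (Real.exp (-(1/2) * ((∑ j, ∑ μ : Fin 4, (a j μ) ^ 2) +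
            ∑ μ : Fin 4, (∑ j, a j μ) ^ 2)) : ℂ)) ∧
      (∫ k : Fin n → Fin 4 → ℝ,
        invFT f k * (regKernel n k : ℂ) *
          Complex.exp (Complex.I * ((mink (∑ j, k j) x : ℝ) : ℂ))) =
      (c : ℂ) * ∫ a : Fin (n - 1) → Fin 4 → ℝ,
        f (diagShift n x a) *
          (Real.exp (-(1/2) * ((∑ j, ∑ μ : Fin 4, (a j μ) ^ 2) +
            ∑ μ : Fin 4, (∑ j, a j μ) ^ 2)) : ℂ) := by
  obtain ⟨m, rfl⟩ : ∃ m, n = m + 1 := ⟨n - 1, by omega⟩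
  obtain ⟨c, hc, h⟩ := main_succ m
  exact ⟨c, hc, fun f x => h f x⟩
end

section
/- Let N ≥ 1 and let λ' be a Schwartz function on ℝ. Define T : ℝ^N → ℂ by T(p₁,…,p_N) = ∫_{ℝ^N} 𝟙[β₁ ≤ β₂ ≤ … ≤ β_N] ( ∏_{M=1}^N λ'(β_M) ) exp( i Σ_{M=1}^N p_M β_M ) dβ₁⋯dβ_N. Then for every p the integrand is Lebesgue-integrable, T is a C^∞ function, T and all its iterated partial derivatives are bounded on ℝ^N, and T and all its iterated partial derivatives tend to 0 as |p| → ∞. -/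
open MeasureTheory Filter
open scoped BigOperators

/-- The time-ordered integral `T(p) = ∫ 𝟙[β₁ ≤ … ≤ β_N] ∏ λ'(β_M) e^{i Σ p_M β_M} dβ`. -/
noncomputable def timeOrderedT (N : ℕ) (lam' : SchwartzMap ℝ ℂ) (p : Fin N → ℝ) : ℂ :=
  ∫ β : Fin N → ℝ,
    Set.indicator {β : Fin N → ℝ | Monotone β}
      (fun β => (∏ M, lam' (β M)) *
        Complex.exp (Complex.I * ((∑ M, p M * β M : ℝ) : ℂ))) β

open scoped FourierTransform

/-- The pairing `(β, p) ↦ -(2π)⁻¹ ∑ p_M β_M`. -/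
noncomputable def totPairing (N : ℕ) : (Fin N → ℝ) →L[ℝ] (Fin N → ℝ) →L[ℝ] ℝ :=
  (-(2 * Real.pi)⁻¹ : ℝ) • ∑ M : Fin N,
    (ContinuousLinearMap.proj (R := ℝ) (φ := fun _ : Fin N => ℝ) M).smulRight
      (ContinuousLinearMap.proj (R := ℝ) (φ := fun _ : Fin N => ℝ) M)

lemma totPairing_apply (N : ℕ) (v w : Fin N → ℝ) :
    totPairing N v w = -(2 * Real.pi)⁻¹ * ∑ M, w M * v M := by
  simp [totPairing, mul_comm]

/-- The amplitude. -/
noncomputable def totAmp (N : ℕ) (lam' : SchwartzMap ℝ ℂ) (β : Fin N → ℝ) : ℂ :=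
  Set.indicator {β : Fin N → ℝ | Monotone β} (fun β => ∏ M, lam' (β M)) β

lemma tot_integrand (N : ℕ) (lam' : SchwartzMap ℝ ℂ) (p β : Fin N → ℝ) :
    Set.indicator {β : Fin N → ℝ | Monotone β}
      (fun β => (∏ M, lam' (β M)) *
        Complex.exp (Complex.I * ((∑ M, p M * β M : ℝ) : ℂ))) β =
    𝐞 (-(totPairing N).toLinearMap₁₂ β p) • totAmp N lam' β := by
  have h1 : (totPairing N).toLinearMap₁₂ β p = totPairing N β p := rfl
  have h2 : 2 * Real.pi * ((2 * Real.pi)⁻¹ * ∑ M, p M * β M) = ∑ M, p M * β M := by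
    field_simp
  rw [h1, totPairing_apply, Circle.smul_def, Real.fourierChar_apply, neg_mul, neg_neg, h2,
    mul_comm _ Complex.I]
  by_cases hm : Monotone β
  · simp [totAmp, Set.indicator, hm, mul_comm]
  · simp [totAmp, Set.indicator, hm]

lemma timeOrderedT_eq (N : ℕ) (lam' : SchwartzMap ℝ ℂ) :
    timeOrderedT N lam' = VectorFourier.fourierIntegral 𝐞 volume
      (totPairing N).toLinearMap₁₂ (totAmp N lam') := by
  funext p
  simp only [timeOrderedT, VectorFourier.fourierIntegral]
  exact integral_congr_ae (Eventually.of_forall fun β => tot_integrand N lam' p β)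

lemma totAmp_meas (N : ℕ) (lam' : SchwartzMap ℝ ℂ) :
    AEStronglyMeasurable (totAmp N lam') volume := by
  apply AEStronglyMeasurable.indicator
  · apply Continuous.aestronglyMeasurable
    have := lam'.continuous
    fun_prop
  · exact isClosed_monotone.measurableSet

lemma tot_norm_le (N : ℕ) (v : Fin N → ℝ) : ‖v‖ ≤ ∏ M, (1 + ‖v M‖) := by
  have h1 : ∀ s : Finset (Fin N), 1 ≤ ∏ M ∈ s, (1 + ‖v M‖) := fun s =>
    Finset.induction_on s (by simp) fun a t ha ih => by
      rw [Finset.prod_insert ha]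
      nlinarith [norm_nonneg (v a)]
  refine (pi_norm_le_iff_of_nonneg (zero_le_one.trans (h1 _))).2 fun i => ?_
  rw [← Finset.mul_prod_erase _ _ (Finset.mem_univ i)]
  nlinarith [norm_nonneg (v i), h1 (Finset.univ.erase i)]

lemma tot_int_one (lam' : SchwartzMap ℝ ℂ) (n : ℕ) :
    Integrable (fun x : ℝ => (1 + ‖x‖) ^ n * ‖lam' x‖) := by
  have h := ((lam'.integrable_pow_mul volume 0).add (lam'.integrable_pow_mul volume n)).const_mul
    ((2 : ℝ) ^ (n - 1))
  refine h.mono' ?_ (Eventually.of_forall fun x => ?_)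
  · apply Continuous.aestronglyMeasurable
    have := lam'.continuous
    fun_prop
  · have := add_pow_le (zero_le_one) (norm_nonneg x) n
    rw [Real.norm_of_nonneg (by positivity)]
    calc _ ≤ (2 ^ (n - 1) * (1 ^ n + ‖x‖ ^ n)) * ‖lam' x‖ := by gcongr
      _ = _ := by simp; ring

lemma totAmp_int (N : ℕ) (lam' : SchwartzMap ℝ ℂ) (n : ℕ) :
    Integrable (fun v => ‖v‖ ^ n * ‖totAmp N lam' v‖) := by
  have h : Integrable (fun v : Fin N → ℝ => ∏ M, ((1 + ‖v M‖) ^ n * ‖lam' (v M)‖)) :=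
    Integrable.fintype_prod (fun _ => tot_int_one lam' n)
  refine h.mono' ?_ (Eventually.of_forall fun v => ?_)
  · exact (continuous_norm.pow n).aestronglyMeasurable.mul (totAmp_meas N lam').norm
  · rw [Real.norm_of_nonneg (by positivity), Finset.prod_mul_distrib, Finset.prod_pow]
    have h2 : ‖totAmp N lam' v‖ ≤ ∏ M, ‖lam' (v M)‖ := by
      rw [← norm_prod]
      exact norm_indicator_le_norm_self (fun β : Fin N → ℝ => ∏ M, lam' (β M)) v
    have := tot_norm_le N v
    gcongr

lemma tot_flip_cocompact (N : ℕ) :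
    Tendsto (fun p : Fin N → ℝ => (totPairing N).flip p) (cocompact _) (cocompact _) := by
  have hinj : Function.Injective ((totPairing N).flip) := by
    rw [injective_iff_map_eq_zero]
    intro p hp
    funext i
    have := congrArg (fun f => f (Pi.single i 1)) hp
    simp only [ContinuousLinearMap.flip_apply, totPairing_apply] at this
    simpa [Pi.single_apply, Real.pi_ne_zero] using this
  exact (LinearMap.isClosedEmbedding_of_injective
    (f := ((totPairing N).flip : (Fin N → ℝ) →ₗ[ℝ] ((Fin N → ℝ) →L[ℝ] ℝ)))
    (LinearMap.ker_eq_bot.2 hinj)).tendsto_cocompact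

lemma tot_riemann_lebesgue {E : Type*} [NormedAddCommGroup E] [NormedSpace ℂ E] (N : ℕ)
    (f : (Fin N → ℝ) → E) :
    Tendsto (fun p => VectorFourier.fourierIntegral 𝐞 volume (totPairing N).toLinearMap₁₂ f p)
      (cocompact (Fin N → ℝ)) (nhds 0) := by
  have h := (tendsto_integral_exp_smul_cocompact f volume).comp (tot_flip_cocompact N)
  exact h

theorem timeOrderedT_smooth_bounded_vanishing (N : ℕ) (hN : 1 ≤ N)
    (lam' : SchwartzMap ℝ ℂ) :
    (∀ p : Fin N → ℝ, Integrable (fun β : Fin N → ℝ =>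
      Set.indicator {β : Fin N → ℝ | Monotone β}
        (fun β => (∏ M, lam' (β M)) *
          Complex.exp (Complex.I * ((∑ M, p M * β M : ℝ) : ℂ))) β)) ∧
    ContDiff ℝ (⊤ : ℕ∞) (timeOrderedT N lam') ∧
    (∀ i : ℕ, ∃ C : ℝ, ∀ p : Fin N → ℝ,
      ‖iteratedFDeriv ℝ i (timeOrderedT N lam') p‖ ≤ C) ∧
    (∀ i : ℕ, Tendsto (fun p : Fin N → ℝ => iteratedFDeriv ℝ i (timeOrderedT N lam') p)
      (cocompact (Fin N → ℝ)) (nhds 0)) := by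
  have hd : ∀ i : ℕ, iteratedFDeriv ℝ i (timeOrderedT N lam') =
      VectorFourier.fourierIntegral 𝐞 volume (totPairing N).toLinearMap₁₂
        (fun v => VectorFourier.fourierPowSMulRight (totPairing N) (totAmp N lam') v i) := fun i => by
    rw [timeOrderedT_eq]
    exact VectorFourier.iteratedFDeriv_fourierIntegral (totPairing N) (N := ⊤)
      (fun n _ => totAmp_int N lam' n) (totAmp_meas N lam') (n := i) le_top
  refine ⟨fun p => ?_, ?_, fun i => ?_, fun i => ?_⟩
  · simp_rw [tot_integrand]
    have hI : Integrable (totAmp N lam') := by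
      have := totAmp_int N lam' 0
      simp only [pow_zero, one_mul] at this
      exact (integrable_norm_iff (totAmp_meas N lam')).1 this
    exact (VectorFourier.fourierIntegral_convergent_iff Real.continuous_fourierChar
      (by apply (totPairing N).continuous₂) p).2 hI
  · rw [timeOrderedT_eq]
    exact VectorFourier.contDiff_fourierIntegral _ (fun n _ => totAmp_int N lam' n)
  · rw [hd i]
    exact ⟨_, fun p => VectorFourier.norm_fourierIntegral_le_integral_norm _ _ _ _ p⟩
  · rw [hd i]
    exact tot_riemann_lebesgue N _
end
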